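/- Let φ be a monotonic nonessential enhancement of site percolation on the square lattice ℤ². Then there exist constants c₂ ∈ (0,∞) and M < ∞, depending only on the enhancement, such that for every s ∈ [0,1], every p ∈ (0, p_c], and every x ∈ ℤ² with Euclidean norm |x| ≥ M: τ_p(x) ≤ τ_{p,s}(x) ≤ p^{−c₂} · τ_p(x). -/

import Mathlib

open MeasureTheory Filter Set Topology
open scoped ENNReal

namespace PercEnh

/-- Sites of the lattice (vertex set `ℤ²`). -/
abbrev Site : Type := ℤ × ℤ

/-- A configuration: the set of open sites. -/
abbrev Config : Type := Set Site

/-- Square-lattice (`ℤ²`-) adjacency: `‖x − y‖₁ = 1`. -/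
def adjZ2 (x y : Site) : Prop := |x.1 - y.1| + |x.2 - y.2| = 1

/-- Matching (star) adjacency: `x ≠ y` and `‖x − y‖_∞ = 1`. -/
def adjStar (x y : Site) : Prop := x ≠ y ∧ max |x.1 - y.1| |x.2 - y.2| = 1

/-- Euclidean norm of a site. -/
noncomputable def siteNorm (x : Site) : ℝ := Real.sqrt ((x.1 : ℝ) ^ 2 + (x.2 : ℝ) ^ 2)

/-- Sites in the closed Euclidean ball of radius `r` centred at the origin. -/
def siteBall (r : ℝ) : Set Site := {x | siteNorm x ≤ r}

/-- The shifted configuration `τ_x ω = {y − x : y ∈ ω}`. -/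
def shiftConfig (x : Site) (ω : Config) : Config := {y | y + x ∈ ω}

/-- An enhancement function of (finite) range `R₀`: takes values in subsets of
`𝔹₀ = ℤ² ∩ B(R₀)` and depends only on the restriction of the configuration to `𝔹₀`. -/
def IsEnhancement (R₀ : ℝ) (φ : Config → Config) : Prop :=
  0 ≤ R₀ ∧ (∀ ω, φ ω ⊆ siteBall R₀) ∧
    ∀ ω ω' : Config, ω ∩ siteBall R₀ = ω' ∩ siteBall R₀ → φ ω = φ ω'

/-- A monotonic enhancement function. -/
def Monotonic (φ : Config → Config) : Prop := ∀ ω ω' : Config, ω ⊆ ω' → φ ω ⊆ φ ω'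

/-- The translate `φ_x(ω) = x + φ₀(τ_x ω)`. -/
def enhAt (φ : Config → Config) (x : Site) (ω : Config) : Config :=
  (fun z => z + x) '' φ (shiftConfig x ω)

/-- The enhanced configuration `ω̂(ω, α) = ω ∪ ⋃_{x : α(x)=1} φ_x(ω)`. -/
def enhanced (φ : Config → Config) (ω : Config) (α : Site → Bool) : Config :=
  ω ∪ {y | ∃ x, α x = true ∧ y ∈ enhAt φ x ω}

/-- The fully (deterministically, with `s = 1`) enhanced configuration `ω̃`. -/
def fullyEnhanced (φ : Config → Config) (ω : Config) : Config :=
  ω ∪ {y | ∃ x, y ∈ enhAt φ x ω}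

/-- `ω` contains a doubly-infinite self-repelling path (w.r.t. adjacency `adj`):
a two-sided sequence of distinct sites of `ω` in which exactly the consecutive
pairs are adjacent. -/
def HasDISRPath (adj : Site → Site → Prop) (ω : Config) : Prop :=
  ∃ γ : ℤ → Site, Function.Injective γ ∧ (∀ i, γ i ∈ ω) ∧
    ∀ i j : ℤ, adj (γ i) (γ j) ↔ (j = i + 1 ∨ i = j + 1)

/-- The enhancement is essential: some configuration without a doubly-infinite
self-repelling path acquires one upon enhancement at the origin. -/
def Essential (adj : Site → Site → Prop) (φ : Config → Config) : Prop :=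
  ∃ ω : Config, ¬ HasDISRPath adj ω ∧ HasDISRPath adj (ω ∪ φ ω)

/-- A (finite, nonempty) path w.r.t. adjacency `adj`: distinct sites,
consecutive ones adjacent. -/
def IsPathOn (adj : Site → Site → Prop) (l : List Site) : Prop :=
  l ≠ [] ∧ l.Nodup ∧ l.Chain' adj

/-- `x` and `y` are joined by a path of sites of `ω`. -/
def ConnectedIn (adj : Site → Site → Prop) (ω : Config) (x y : Site) : Prop :=
  ∃ l : List Site, IsPathOn adj l ∧ (∀ z ∈ l, z ∈ ω) ∧
    l.head? = some x ∧ l.getLast? = some y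

/-- `x` belongs to an infinite open cluster of `ω`. -/
def InInfiniteCluster (adj : Site → Site → Prop) (ω : Config) (x : Site) : Prop :=
  {y | ConnectedIn adj ω x y}.Infinite

/-- `ω` contains an infinite open cluster. -/
def HasInfiniteCluster (adj : Site → Site → Prop) (ω : Config) : Prop :=
  ∃ x, InInfiniteCluster adj ω x

/-- The configuration corresponding to `η : Site → Bool`. -/
def toConfig (η : Site → Bool) : Config := {x | η x = true}

/-- A cylinder event. -/
def cylinder (F : Finset Site) (b : Site → Bool) : Set (Site → Bool) :=
  {η | ∀ x ∈ F, η x = b x}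

/-- `μ` is the Bernoulli product measure with density `p` of open sites. -/
def IsBernoulli (p : ℝ) (μ : Measure (Site → Bool)) : Prop :=
  IsProbabilityMeasure μ ∧
    ∀ (F : Finset Site) (b : Site → Bool),
      μ (cylinder F b) = ∏ x ∈ F, ENNReal.ofReal (if b x then p else 1 - p)

/-- The percolation probability `θ`: the probability that the origin lies in an
infinite open cluster. -/
noncomputable def theta (adj : Site → Site → Prop) (μ : Measure (Site → Bool)) : ℝ :=
  (μ {η | InInfiniteCluster adj (toConfig η) 0}).toReal

/-- The percolation probability of the enhanced process (`μ` the law of the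
configuration, `ν` the law of the activation variables). -/
noncomputable def thetaEnh (adj : Site → Site → Prop) (φ : Config → Config)
    (μ ν : Measure (Site → Bool)) : ℝ :=
  ((μ.prod ν) {ηα | InInfiniteCluster adj (enhanced φ (toConfig ηα.1) ηα.2) 0}).toReal

/-- The critical point `p_c = sup {p ∈ [0,1] : θ(p) = 0}` for the family `P`. -/
noncomputable def pcOf (adj : Site → Site → Prop) (P : ℝ → Measure (Site → Bool)) : ℝ :=
  sSup {p | p ∈ Icc (0:ℝ) 1 ∧ theta adj (P p) = 0}

/-- The connectivity function `τ_p(x)`. -/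
noncomputable def tau (adj : Site → Site → Prop) (μ : Measure (Site → Bool)) (x : Site) : ℝ :=
  (μ {η | ConnectedIn adj (toConfig η) 0 x}).toReal

/-- The connectivity function `τ_{p,s}(x)` of the enhanced process. -/
noncomputable def tauEnh (adj : Site → Site → Prop) (φ : Config → Config)
    (μ ν : Measure (Site → Bool)) (x : Site) : ℝ :=
  ((μ.prod ν) {ηα | ConnectedIn adj (enhanced φ (toConfig ηα.1) ηα.2) 0 x}).toReal

/-- The mean cluster size `χ(p) = E_p‖C‖ = ∑_x τ_p(x)`. -/
noncomputable def chi (adj : Site → Site → Prop) (μ : Measure (Site → Bool)) : ℝ≥0∞ :=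
  ∑' x : Site, μ {η | ConnectedIn adj (toConfig η) 0 x}

/-- The mean cluster size of the enhanced process. -/
noncomputable def chiEnh (adj : Site → Site → Prop) (φ : Config → Config)
    (μ ν : Measure (Site → Bool)) : ℝ≥0∞ :=
  ∑' x : Site, (μ.prod ν) {ηα | ConnectedIn adj (enhanced φ (toConfig ηα.1) ηα.2) 0 x}


/-- The subgraph of the square lattice spanned by the open sites of `ω`. -/
def siteGraph (ω : Config) : SimpleGraph Site where
  Adj a b := adjZ2 a b ∧ a ∈ ω ∧ b ∈ ω
  symm := ⟨fun a b h => ⟨by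
    have h1 := h.1
    unfold adjZ2 at h1 ⊢
    rwa [abs_sub_comm b.1, abs_sub_comm b.2], h.2.2, h.2.1⟩⟩
  loopless := ⟨fun a h => by simpa [adjZ2] using h.1⟩

theorem adjZ2_iff (x y : Site) : adjZ2 x y ↔
    (x.1 = y.1 ∧ (x.2 = y.2 + 1 ∨ y.2 = x.2 + 1)) ∨
      (x.2 = y.2 ∧ (x.1 = y.1 + 1 ∨ y.1 = x.1 + 1)) := by
  unfold adjZ2
  rcases abs_cases (x.1 - y.1) with h | h <;> rcases abs_cases (x.2 - y.2) with h' | h' <;> omega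

theorem adjZ2_comm (x y : Site) : adjZ2 x y ↔ adjZ2 y x := by
  rw [adjZ2_iff, adjZ2_iff]; omega

theorem siteGraph_mono {ω ω' : Config} (h : ω ⊆ ω') : siteGraph ω ≤ siteGraph ω' :=
  fun _ _ hab => ⟨hab.1, h hab.2.1, h hab.2.2⟩

theorem mem_of_mem_support {ω : Config} {x y z : Site} (w : (siteGraph ω).Walk x y)
    (hx : x ∈ ω) (hz : z ∈ w.support) : z ∈ ω := by
  induction w with
  | nil => simp_all
  | cons h w ih =>
    rw [SimpleGraph.Walk.support_cons, List.mem_cons] at hz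
    rcases hz with rfl | hz
    · exact hx
    · exact ih h.2.2 hz

theorem connectedIn_iff (ω : Config) (x y : Site) :
    ConnectedIn adjZ2 ω x y ↔ x ∈ ω ∧ (siteGraph ω).Reachable x y := by
  constructor
  · rintro ⟨l, ⟨hne, -, hch⟩, hω, hx, hy⟩
    induction l generalizing x with
    | nil => exact absurd rfl hne
    | cons a l ih =>
      obtain rfl : a = x := by simpa using hx
      refine ⟨hω a (by simp), ?_⟩
      cases l with
      | nil =>
        obtain rfl : a = y := by simpa using hy
        exact SimpleGraph.Reachable.refl _
      | cons b l =>
        have hch' := List.isChain_cons_cons.1 hch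
        have hb := ih b (by simp) hch'.2 (fun z hz => hω z (by simp_all)) rfl (by simpa using hy)
        have hab : (siteGraph ω).Adj a b := ⟨hch'.1, hω a (by simp), hb.1⟩
        exact hab.reachable.trans hb.2
  · rintro ⟨hx, ⟨w⟩⟩
    classical
    refine ⟨w.toPath.1.support, ⟨by simp, w.toPath.2.support_nodup, ?_⟩,
      fun z hz => mem_of_mem_support _ hx hz, ?_, ?_⟩
    · exact (SimpleGraph.Walk.isChain_adj_support _).imp fun a b h => h.1
    · rw [List.head?_eq_some_head (by simp), SimpleGraph.Walk.head_support]
    · rw [List.getLast?_eq_some_getLast (by simp), SimpleGraph.Walk.getLast_support]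

theorem ConnectedIn.mono {ω ω' : Config} (h : ω ⊆ ω') {x y : Site}
    (hc : ConnectedIn adjZ2 ω x y) : ConnectedIn adjZ2 ω' x y := by
  obtain ⟨l, hl, hω, hxy⟩ := hc
  exact ⟨l, hl, fun z hz => h (hω z hz), hxy⟩

/-- The box `[-R, R]²`. -/
def siteBox (R : ℤ) : Set Site := {z | -R ≤ z.1 ∧ z.1 ≤ R ∧ -R ≤ z.2 ∧ z.2 ≤ R}

/-- The open box `(-R, R)²`. -/
def siteBoxInt (R : ℤ) : Set Site := {z | -R < z.1 ∧ z.1 < R ∧ -R < z.2 ∧ z.2 < R}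

theorem siteBox_finite (R : ℤ) : (siteBox R).Finite :=
  ((Set.finite_Icc (-R) R).prod (Set.finite_Icc (-R) R)).subset
    fun _ hz => ⟨⟨hz.1, hz.2.1⟩, hz.2.2.1, hz.2.2.2⟩

theorem siteBall_subset_siteBoxInt {r : ℝ} {R : ℤ} (h : r < R) : siteBall r ⊆ siteBoxInt R := by
  intro z hz
  have hz : Real.sqrt ((z.1 : ℝ) ^ 2 + (z.2 : ℝ) ^ 2) ≤ r := hz
  have h1 : |(z.1 : ℝ)| < R :=
    ((Real.abs_le_sqrt (by nlinarith [sq_nonneg (z.2 : ℝ)])).trans hz).trans_lt h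
  have h2 : |(z.2 : ℝ)| < R :=
    ((Real.abs_le_sqrt (by nlinarith [sq_nonneg (z.1 : ℝ)])).trans hz).trans_lt h
  rw [abs_lt] at h1 h2
  exact ⟨by exact_mod_cast h1.1, by exact_mod_cast h1.2, by exact_mod_cast h2.1,
    by exact_mod_cast h2.2⟩

/-- `e` is a unit vector pointing out of the box `[-R, R]²` at its boundary site `u`. -/
def Outward (R : ℤ) (u e : Site) : Prop :=
  (e = (1, 0) ∧ u.1 = R) ∨ (e = (-1, 0) ∧ u.1 = -R) ∨
    (e = (0, 1) ∧ u.2 = R) ∨ (e = (0, -1) ∧ u.2 = -R)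

theorem exists_outward {R : ℤ} {u : Site} (hu : u ∈ siteBox R) (hu' : u ∉ siteBoxInt R) :
    ∃ e, Outward R u e := by
  simp only [siteBox, siteBoxInt, mem_ofPred_eq] at hu hu'
  have : u.1 = R ∨ u.1 = -R ∨ u.2 = R ∨ u.2 = -R := by omega
  rcases this with h | h | h | h
  · exact ⟨_, Or.inl ⟨rfl, h⟩⟩
  · exact ⟨_, Or.inr (Or.inl ⟨rfl, h⟩)⟩
  · exact ⟨_, Or.inr (Or.inr (Or.inl ⟨rfl, h⟩))⟩
  · exact ⟨_, Or.inr (Or.inr (Or.inr ⟨rfl, h⟩))⟩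

/-- The site at distance `t` from `u` in direction `e`. -/
def arm (u e : Site) (t : ℤ) : Site := (u.1 + t * e.1, u.2 + t * e.2)

theorem arm_notMem_siteBox {R : ℤ} {u e : Site} (h : Outward R u e) {t : ℤ} (ht : 1 ≤ t) :
    arm u e t ∉ siteBox R := by
  rcases h with ⟨rfl, h⟩ | ⟨rfl, h⟩ | ⟨rfl, h⟩ | ⟨rfl, h⟩ <;>
    simp only [arm, siteBox, mem_ofPred_eq] <;> omega

theorem adjZ2_arm_of_mem {R : ℤ} {u e z : Site} (h : Outward R u e) {t : ℤ}
    (ht : 1 ≤ t) (hz : z ∈ siteBox R) : adjZ2 (arm u e t) z ↔ t = 1 ∧ z = u := by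
  rw [adjZ2_iff, Prod.ext_iff]
  simp only [siteBox, mem_ofPred_eq] at hz
  rcases h with ⟨rfl, h⟩ | ⟨rfl, h⟩ | ⟨rfl, h⟩ | ⟨rfl, h⟩ <;> simp only [arm] <;> omega

theorem adjZ2_arm_arm {R : ℤ} {u e : Site} (h : Outward R u e) (t t' : ℤ) :
    adjZ2 (arm u e t) (arm u e t') ↔ t' = t + 1 ∨ t = t' + 1 := by
  rw [adjZ2_iff]
  rcases h with ⟨rfl, h⟩ | ⟨rfl, h⟩ | ⟨rfl, h⟩ | ⟨rfl, h⟩ <;> simp only [arm] <;> omega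

theorem arm_injective {R : ℤ} {u e : Site} (h : Outward R u e) :
    Function.Injective (arm u e) := by
  intro t t' htt
  rw [Prod.ext_iff] at htt
  rcases h with ⟨rfl, h⟩ | ⟨rfl, h⟩ | ⟨rfl, h⟩ | ⟨rfl, h⟩ <;> simp only [arm] at htt <;> omega

theorem arm_separated {R : ℤ} {u v e e' : Site} (hu : u ∈ siteBox R) (hv : v ∈ siteBox R)
    (huv : u ≠ v) (hadj : ¬ adjZ2 u v) (he : Outward R u e) (he' : Outward R v e')
    {t t' : ℤ} (ht : 1 ≤ t) (ht' : 1 ≤ t') :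
    ¬ adjZ2 (arm u e t) (arm v e' t') ∧ arm u e t ≠ arm v e' t' := by
  rw [adjZ2_iff] at hadj ⊢
  rw [Ne, Prod.ext_iff] at huv ⊢
  simp only [siteBox, mem_ofPred_eq] at hu hv
  rcases he with ⟨rfl, h⟩ | ⟨rfl, h⟩ | ⟨rfl, h⟩ | ⟨rfl, h⟩ <;>
    rcases he' with ⟨rfl, h'⟩ | ⟨rfl, h'⟩ | ⟨rfl, h'⟩ | ⟨rfl, h'⟩ <;>
    simp only [arm] <;> omega

theorem mem_range_of_injective_of_le_succ {f : ℕ → ℕ} (hf : Function.Injective f)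
    (hstep : ∀ n, f (n + 1) ≤ f n + 1) {m : ℕ} (hm : f 0 ≤ m) : m ∈ range f := by
  by_contra hmem
  have hne : ∀ n, f n ≠ m := fun n h => hmem ⟨n, h⟩
  have hlt : ∀ n, f n < m := by
    intro n
    induction n with
    | zero => exact lt_of_le_of_ne hm (hne 0)
    | succ n ih => exact lt_of_le_of_ne ((hstep n).trans ih) (hne _)
  exact (Set.infinite_range_of_injective hf)
    ((Set.finite_lt_nat m).subset (by rintro _ ⟨n, rfl⟩; exact hlt n))

/-- A one-sided infinite path which stays on an arm covers all of it from some point on. -/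
theorem tail_subset_range_of_mem_arm {R : ℤ} {u e : Site} (he : Outward R u e)
    {σ : ℕ → Site} (hinj : Function.Injective σ) (hadj : ∀ n, adjZ2 (σ n) (σ (n + 1))) {N : ℕ}
    (harm : ∀ n ≥ N, ∃ t : ℤ, 1 ≤ t ∧ σ n = arm u e t) :
    ∃ T : ℤ, 1 ≤ T ∧ ∀ t ≥ T, arm u e t ∈ range σ := by
  choose f hf1 hf using fun n => harm (N + n) (Nat.le_add_right _ _)
  have hinj' : Function.Injective fun n => (f n).toNat := by
    intro a b hab
    have hab' : f a = f b := by have := hf1 a; have := hf1 b; simp only at hab; omega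
    have : σ (N + a) = σ (N + b) := by rw [hf, hf, hab']
    have := hinj this
    omega
  have hstep : ∀ n, (f (n + 1)).toNat ≤ (f n).toNat + 1 := by
    intro n
    have h := hadj (N + n)
    rw [hf n, add_assoc, hf (n + 1), adjZ2_arm_arm he] at h
    omega
  refine ⟨f 0, hf1 0, fun t ht => ?_⟩
  obtain ⟨n, hn⟩ := mem_range_of_injective_of_le_succ hinj' hstep (m := t.toNat)
    (by have := hf1 0; omega)
  refine ⟨N + n, ?_⟩
  rw [hf n]
  congr 1
  have := hf1 n
  have := hf1 0
  simp only at hn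
  omega

/-- Replacement of the configuration outside the box by the two arms. -/
def armConfig (R : ℤ) (ω : Config) (u e v e' : Site) : Config :=
  (ω ∩ siteBox R) ∪ ({z | ∃ t : ℤ, 1 ≤ t ∧ z = arm u e t} ∪ {z | ∃ t : ℤ, 1 ≤ t ∧ z = arm v e' t})

theorem exists_tail_subset_range {R : ℤ} {ω : Config} {u v e e' : Site}
    (hu : u ∈ siteBox R) (hv : v ∈ siteBox R)
    (huv : u ≠ v) (hadj : ¬ adjZ2 u v) (he : Outward R u e) (he' : Outward R v e')
    {σ : ℕ → Site} (hinj : Function.Injective σ) (hσ : ∀ n, adjZ2 (σ n) (σ (n + 1)))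
    (hmem : ∀ n, σ n ∈ armConfig R ω u e v e') :
    (∃ T : ℤ, 1 ≤ T ∧ ∀ t ≥ T, arm u e t ∈ range σ) ∨
      ∃ T : ℤ, 1 ≤ T ∧ ∀ t ≥ T, arm v e' t ∈ range σ := by
  obtain ⟨N, hN⟩ : ∃ N, ∀ n ≥ N, σ n ∉ siteBox R := by
    have hfin : (σ ⁻¹' siteBox R).Finite := (siteBox_finite R).preimage hinj.injOn
    obtain ⟨N, hN⟩ := hfin.bddAbove
    exact ⟨N + 1, fun n hn h => by have := hN h; omega⟩
  have harms : ∀ n ≥ N, (∃ t : ℤ, 1 ≤ t ∧ σ n = arm u e t) ∨ ∃ t : ℤ, 1 ≤ t ∧ σ n = arm v e' t :=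
    fun n hn => (hmem n).resolve_left fun h => hN n hn h.2
  rcases harms N le_rfl with h | h
  · left
    refine tail_subset_range_of_mem_arm he hinj hσ (N := N) fun n hn => ?_
    induction n, hn using Nat.le_induction with
    | base => exact h
    | succ n hn ih =>
      refine (harms (n + 1) (by omega)).resolve_right ?_
      rintro ⟨t', ht', h'⟩
      obtain ⟨t, ht, h⟩ := ih
      have := hσ n
      rw [h, h'] at this
      exact (arm_separated hu hv huv hadj he he' ht ht').1 this
  · right
    refine tail_subset_range_of_mem_arm he' hinj hσ (N := N) fun n hn => ?_
    induction n, hn using Nat.le_induction with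
    | base => exact h
    | succ n hn ih =>
      refine (harms (n + 1) (by omega)).resolve_left ?_
      rintro ⟨t', ht', h'⟩
      obtain ⟨t, ht, h⟩ := ih
      have := hσ n
      rw [h, h', adjZ2_comm] at this
      exact (arm_separated hu hv huv hadj he he' ht' ht).1 this

theorem reachable_of_hasDISRPath_armConfig {R : ℤ} {ω : Config} {u v e e' : Site}
    (hu : u ∈ siteBox R) (hv : v ∈ siteBox R)
    (huv : u ≠ v) (hadj : ¬ adjZ2 u v) (he : Outward R u e) (he' : Outward R v e')
    (h : HasDISRPath adjZ2 (armConfig R ω u e v e')) :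
    (siteGraph ω).Reachable u v := by
  classical
  obtain ⟨δ, hinj, hmem, hδ⟩ := h
  -- contract each arm to its base point
  let f : Site → Site := fun z =>
    if z ∈ siteBox R then z else if ∃ t : ℤ, 1 ≤ t ∧ z = arm u e t then u else v
  have hf1 : ∀ z ∈ siteBox R, f z = z := fun z hz => if_pos hz
  have hf2 : ∀ t : ℤ, 1 ≤ t → f (arm u e t) = u := fun t ht => by
    simp only [f, if_neg (arm_notMem_siteBox he ht)]
    exact if_pos ⟨t, ht, rfl⟩
  have hf3 : ∀ t : ℤ, 1 ≤ t → f (arm v e' t) = v := fun t ht => by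
    simp only [f, if_neg (arm_notMem_siteBox he' ht)]
    refine if_neg ?_
    rintro ⟨t', ht', h⟩
    exact (arm_separated hu hv huv hadj he he' ht' ht).2 h.symm
  have hstep : ∀ a b, a ∈ armConfig R ω u e v e' → b ∈ armConfig R ω u e v e' → adjZ2 a b →
      (siteGraph ω).Reachable (f a) (f b) := by
    rintro a b (⟨haω, ha⟩ | ⟨t, ht, rfl⟩ | ⟨t, ht, rfl⟩)
      (⟨hbω, hb⟩ | ⟨t', ht', rfl⟩ | ⟨t', ht', rfl⟩) hab
    · rw [hf1 a ha, hf1 b hb]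
      have : (siteGraph ω).Adj a b := ⟨hab, haω, hbω⟩
      exact this.reachable
    · rw [adjZ2_comm, adjZ2_arm_of_mem he ht' ha] at hab
      rw [hf1 a ha, hf2 t' ht', hab.2]
    · rw [adjZ2_comm, adjZ2_arm_of_mem he' ht' ha] at hab
      rw [hf1 a ha, hf3 t' ht', hab.2]
    · rw [adjZ2_arm_of_mem he ht hb] at hab
      rw [hf1 b hb, hf2 t ht, hab.2]
    · rw [hf2 t ht, hf2 t' ht']
    · exact absurd hab (arm_separated hu hv huv hadj he he' ht ht').1
    · rw [adjZ2_arm_of_mem he' ht hb] at hab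
      rw [hf1 b hb, hf3 t ht, hab.2]
    · rw [adjZ2_comm] at hab
      exact absurd hab (arm_separated hu hv huv hadj he he' ht' ht).1
    · rw [hf3 t ht, hf3 t' ht']
  have hnat : ∀ (i : ℤ) (n : ℕ), (siteGraph ω).Reachable (f (δ i)) (f (δ (i + n))) := by
    intro i n
    induction n with
    | zero => simp
    | succ n ih =>
      refine ih.trans (hstep _ _ (hmem _) (hmem _) ((hδ _ _).2 (Or.inl ?_)))
      push_cast; ring
  have hreach : ∀ i j : ℤ, (siteGraph ω).Reachable (f (δ i)) (f (δ j)) := by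
    intro i j
    rcases le_total i j with h | h
    · obtain ⟨n, rfl⟩ := Int.le.dest h
      exact hnat i n
    · obtain ⟨n, rfl⟩ := Int.le.dest h
      exact (hnat j n).symm
  have hpos := exists_tail_subset_range (σ := fun n : ℕ => δ n) hu hv huv hadj he he'
    (fun a b h => by simpa using hinj h) (fun n => (hδ _ _).2 (by simp)) (fun n => hmem _)
  have hneg := exists_tail_subset_range (σ := fun n : ℕ => δ (-n - 1)) hu hv huv hadj he he'
    (fun a b h => by simpa using hinj h)
    (fun n => (hδ _ _).2 (Or.inr (by push_cast; ring))) (fun n => hmem _)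
  have hdisj : ∀ z, z ∈ range (fun n : ℕ => δ n) → z ∉ range (fun n : ℕ => δ (-n - 1)) := by
    rintro z ⟨n, rfl⟩ ⟨m, hm⟩
    have := hinj hm
    omega
  rcases hpos with ⟨T, hT, h⟩ | ⟨T, hT, h⟩ <;> rcases hneg with ⟨T', hT', h'⟩ | ⟨T', hT', h'⟩
  · exact absurd (h' (max T T') (le_max_right _ _)) (hdisj _ (h _ (le_max_left _ _)))
  · obtain ⟨i, hi⟩ := h T le_rfl
    obtain ⟨j, hj⟩ := h' T' le_rfl
    have := hreach i (-j - 1)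
    simp only at hi hj
    rwa [hi, hj, hf2 T hT, hf3 T' hT'] at this
  · obtain ⟨i, hi⟩ := h T le_rfl
    obtain ⟨j, hj⟩ := h' T' le_rfl
    have := hreach (-j - 1) i
    simp only at hi hj
    rwa [hi, hj, hf3 T hT, hf2 T' hT'] at this
  · exact absurd (h' (max T T') (le_max_right _ _)) (hdisj _ (h _ (le_max_left _ _)))

theorem hasDISRPath_of_reachable {R : ℤ} {S : Config} {u v e e' : Site}
    (huS : u ∈ S) (hu : u ∈ siteBox R) (hv : v ∈ siteBox R)
    (huv : u ≠ v) (hadj : ¬ adjZ2 u v) (he : Outward R u e) (he' : Outward R v e')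
    (h : (siteGraph (S ∩ siteBox R)).Reachable u v) :
    HasDISRPath adjZ2 (armConfig R S u e v e') := by
  set G := siteGraph (S ∩ siteBox R)
  obtain ⟨w, hw⟩ := h.exists_walk_length_eq_dist
  set n := w.length with hn
  have hmem : ∀ i, w.getVert i ∈ S ∩ siteBox R := fun i =>
    mem_of_mem_support w ⟨huS, hu⟩ (w.getVert_mem_support i)
  have hstep : ∀ i, i < n → G.Adj (w.getVert i) (w.getVert (i + 1)) := fun i hi =>
    w.adj_getVert_succ hi
  have hdist : ∀ i j, i ≤ j → j ≤ n → j - i ≤ G.dist (w.getVert i) (w.getVert j) := by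
    intro i j hij hj
    have hr : G.Reachable (w.getVert i) (w.getVert j) :=
      ((w.take i).reachable.symm).trans (w.take j).reachable
    obtain ⟨q, hq⟩ := hr.exists_walk_length_eq_dist
    have := SimpleGraph.dist_le (((w.take i).append q).append (w.drop j))
    simp only [SimpleGraph.Walk.length_append, SimpleGraph.Walk.take_length,
      SimpleGraph.Walk.drop_length] at this
    omega
  have hadj' : ∀ i j, i ≤ j → j ≤ n →
      (adjZ2 (w.getVert i) (w.getVert j) ↔ j = i + 1) := by
    intro i j hij hj
    constructor
    · intro h
      have hGA : G.Adj (w.getVert i) (w.getVert j) := ⟨h, hmem i, hmem j⟩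
      have h1 := SimpleGraph.dist_eq_one_iff_adj.2 hGA
      have h2 := hdist i j hij hj
      rcases hij.eq_or_lt with rfl | hlt
      · simp at hGA
      · omega
    · rintro rfl
      exact (hstep i (by omega)).1
  have hinj' : ∀ i j, i ≤ j → j ≤ n → w.getVert i = w.getVert j → i = j := by
    intro i j hij hj h
    have h2 := hdist i j hij hj
    rw [h, SimpleGraph.dist_self] at h2
    omega
  have hw0 : w.getVert 0 = u := w.getVert_zero
  have hwn : w.getVert n = v := w.getVert_length
  let Γ : ℤ → Site := fun i =>
    if i < 0 then arm u e (-i) else if i ≤ n then w.getVert i.toNat else arm v e' (i - n)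
  have hΓ1 : ∀ i, i < 0 → Γ i = arm u e (-i) := fun i hi => if_pos hi
  have hΓ2 : ∀ i : ℤ, 0 ≤ i → i ≤ n → Γ i = w.getVert i.toNat := fun i hi hi' => by
    simp only [Γ, if_neg (not_lt.2 hi), if_pos hi']
  have hΓ3 : ∀ i, (n : ℤ) < i → Γ i = arm v e' (i - n) := fun i hi => by
    simp only [Γ]
    rw [if_neg (by omega), if_neg (by omega)]
  have key : ∀ i j : ℤ, i ≤ j → (adjZ2 (Γ i) (Γ j) ↔ j = i + 1) ∧ (Γ i = Γ j → i = j) := by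
    intro i j hij
    rcases lt_or_ge i 0 with hi | hi
    · rw [hΓ1 i hi]
      rcases lt_or_ge j 0 with hj | hj
      · rw [hΓ1 j hj, adjZ2_arm_arm he]
        exact ⟨by omega, fun h => by have := arm_injective he h; omega⟩
      rcases le_or_gt j n with hj' | hj'
      · rw [hΓ2 j hj hj', adjZ2_arm_of_mem he (by omega) (hmem _).2]
        refine ⟨⟨fun h => ?_, fun h => ?_⟩, fun h => ?_⟩
        · have := hinj' 0 j.toNat (by omega) (by omega) (by rw [hw0, h.2])
          omega
        · have : j.toNat = 0 := by omega
          exact ⟨by omega, by rw [this, hw0]⟩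
        · exact absurd (h ▸ (hmem _).2) (arm_notMem_siteBox he (t := -i) (by omega))
      · rw [hΓ3 j hj']
        have := arm_separated hu hv huv hadj he he' (t := -i) (t' := j - n) (by omega) (by omega)
        exact ⟨⟨fun h => absurd h this.1, fun h => by omega⟩, fun h => absurd h this.2⟩
    rcases le_or_gt i n with hi' | hi'
    · rw [hΓ2 i hi hi']
      rcases le_or_gt j n with hj' | hj'
      · rw [hΓ2 j (by omega) hj', hadj' _ _ (by omega) (by omega)]
        exact ⟨by omega, fun h => by have := hinj' _ _ (by omega) (by omega) h; omega⟩
      · rw [hΓ3 j hj', adjZ2_comm, adjZ2_arm_of_mem he' (by omega) (hmem _).2]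
        refine ⟨⟨fun h => ?_, fun h => ?_⟩, fun h => ?_⟩
        · have := hinj' i.toNat n (by omega) (by omega) (by rw [hwn, h.2])
          omega
        · have : i.toNat = n := by omega
          exact ⟨by omega, by rw [this, hwn]⟩
        · exact absurd (h ▸ (hmem _).2) (arm_notMem_siteBox he' (t := j - n) (by omega))
    · rw [hΓ3 i hi', hΓ3 j (by omega), adjZ2_arm_arm he']
      exact ⟨by omega, fun h => by have := arm_injective he' h; omega⟩
  refine ⟨Γ, fun i j h => ?_, fun i => ?_, fun i j => ?_⟩
  · rcases le_total i j with hij | hij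
    · exact (key i j hij).2 h
    · exact ((key j i hij).2 h.symm).symm
  · rcases lt_or_ge i 0 with hi | hi
    · exact Or.inr (Or.inl ⟨-i, by omega, hΓ1 i hi⟩)
    rcases le_or_gt i n with hi' | hi'
    · rw [hΓ2 i hi hi']
      exact Or.inl (hmem _)
    · exact Or.inr (Or.inr ⟨i - n, by omega, hΓ3 i hi'⟩)
  · rcases le_total i j with hij | hij
    · rw [(key i j hij).1]; omega
    · rw [adjZ2_comm, (key j i hij).1]; omega

theorem HasDISRPath.mono {adj : Site → Site → Prop} {ω ω' : Config} (h : ω ⊆ ω')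
    (hp : HasDISRPath adj ω) : HasDISRPath adj ω' := by
  obtain ⟨γ, hinj, hmem, hadj⟩ := hp
  exact ⟨γ, hinj, fun i => h (hmem i), hadj⟩

theorem siteBoxInt_subset_siteBox (R : ℤ) : siteBoxInt R ⊆ siteBox R := by
  intro z hz
  simp only [siteBox, siteBoxInt, mem_ofPred_eq] at hz ⊢
  omega

/-- A nonessential enhancement at the origin does not create new connections between boundary
sites of a box that contains its range. -/
theorem reachable_of_reachable_box {R₀ : ℝ} {φ : Config → Config} (hφ : IsEnhancement R₀ φ)
    (hness : ¬ Essential adjZ2 φ) {R : ℤ} (hR : R₀ < R) {ω : Config} {u v : Site}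
    (hu : u ∈ siteBox R) (hu' : u ∉ siteBoxInt R) (hv : v ∈ siteBox R) (hv' : v ∉ siteBoxInt R)
    (huω : u ∈ ω) (hvω : v ∈ ω)
    (h : (siteGraph ((ω ∪ φ ω) ∩ siteBox R)).Reachable u v) :
    (siteGraph ω).Reachable u v := by
  by_cases huv : u = v
  · rw [huv]
  by_cases hadj : adjZ2 u v
  · have : (siteGraph ω).Adj u v := ⟨hadj, huω, hvω⟩
    exact this.reachable
  obtain ⟨e, he⟩ := exists_outward hu hu'
  obtain ⟨e', he'⟩ := exists_outward hv hv'
  refine reachable_of_hasDISRPath_armConfig hu hv huv hadj he he' ?_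
  have hball : siteBall R₀ ⊆ siteBox R :=
    (siteBall_subset_siteBoxInt hR).trans (siteBoxInt_subset_siteBox R)
  have hφeq : φ (armConfig R ω u e v e') = φ ω := by
    refine hφ.2.2 _ _ (Set.ext fun z => ⟨?_, fun hz => ⟨Or.inl ⟨hz.1, hball hz.2⟩, hz.2⟩⟩)
    rintro ⟨hz | ⟨t, ht, rfl⟩ | ⟨t, ht, rfl⟩, hzb⟩
    · exact ⟨hz.1, hzb⟩
    · exact absurd (hball hzb) (arm_notMem_siteBox he ht)
    · exact absurd (hball hzb) (arm_notMem_siteBox he' ht)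
  by_contra hno
  refine hness ⟨_, hno, HasDISRPath.mono ?_
    (hasDISRPath_of_reachable (Or.inl huω) hu hv huv hadj he he' h)⟩
  rw [hφeq]
  rintro z (⟨hz | hz, hzb⟩ | hz)
  · exact Or.inl (Or.inl ⟨hz, hzb⟩)
  · exact Or.inr hz
  · exact Or.inl (Or.inr hz)

theorem reachable_of_reachable_union {R₀ : ℝ} {φ : Config → Config} (hφ : IsEnhancement R₀ φ)
    (hness : ¬ Essential adjZ2 φ) {R : ℤ} (hR : R₀ < R) {ω : Config} {a b : Site}
    (ha : a ∉ siteBoxInt R) (hb : b ∉ siteBoxInt R)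
    (h : (siteGraph (ω ∪ φ ω)).Reachable a b) : (siteGraph ω).Reachable a b := by
  have hout : ∀ z ∈ ω ∪ φ ω, z ∉ siteBoxInt R → z ∈ ω := fun z hz hz' =>
    hz.resolve_right fun h => hz' (siteBall_subset_siteBoxInt hR (hφ.2.1 _ h))
  have hbd : ∀ z z', adjZ2 z z' → z ∈ siteBoxInt R → z' ∉ siteBoxInt R → z' ∈ siteBox R := by
    intro z z' h hz hz'
    rw [adjZ2_iff] at h
    simp only [siteBox, siteBoxInt, mem_ofPred_eq] at hz hz' ⊢
    omega
  rw [SimpleGraph.reachable_iff_reflTransGen] at h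
  have key : (b ∉ siteBoxInt R ∧ (siteGraph ω).Reachable a b) ∨
      (b ∈ siteBoxInt R ∧ ∃ u ∈ ω, u ∈ siteBox R ∧ u ∉ siteBoxInt R ∧
        (siteGraph ω).Reachable a u ∧
        (siteGraph ((ω ∪ φ ω) ∩ siteBox R)).Reachable u b) := by
    clear hb
    induction h with
    | refl => exact Or.inl ⟨ha, SimpleGraph.Reachable.refl _⟩
    | @tail z z' _ hzz ih =>
      obtain ⟨hadj, hz, hz'⟩ := hzz
      by_cases hin' : z' ∈ siteBoxInt R
      · refine Or.inr ⟨hin', ?_⟩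
        have hb' := siteBoxInt_subset_siteBox R hin'
        rcases ih with ⟨hin, hr⟩ | ⟨hin, u, huω, hu, hu', hr, hr'⟩
        · have hzb := hbd z' z ((adjZ2_comm _ _).1 hadj) hin' hin
          have hA : (siteGraph ((ω ∪ φ ω) ∩ siteBox R)).Adj z z' :=
            ⟨hadj, ⟨hz, hzb⟩, hz', hb'⟩
          exact ⟨z, hout z hz hin, hzb, hin, hr, hA.reachable⟩
        · have hA : (siteGraph ((ω ∪ φ ω) ∩ siteBox R)).Adj z z' :=
            ⟨hadj, ⟨hz, siteBoxInt_subset_siteBox R hin⟩, hz', hb'⟩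
          exact ⟨u, huω, hu, hu', hr, hr'.trans hA.reachable⟩
      · refine Or.inl ⟨hin', ?_⟩
        have hzω' := hout z' hz' hin'
        rcases ih with ⟨hin, hr⟩ | ⟨hin, u, huω, hu, hu', hr, hr'⟩
        · have hA : (siteGraph ω).Adj z z' := ⟨hadj, hout z hz hin, hzω'⟩
          exact hr.trans hA.reachable
        · have hzb := hbd z z' hadj hin hin'
          have hA : (siteGraph ((ω ∪ φ ω) ∩ siteBox R)).Adj z z' :=
            ⟨hadj, ⟨hz, siteBoxInt_subset_siteBox R hin⟩, hz', hzb⟩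
          exact hr.trans (reachable_of_reachable_box hφ hness hR hu hu' hzb hin' huω hzω'
            (hr'.trans hA.reachable))
  rcases key with h | h
  · exact h.2
  · exact absurd h.1 hb

theorem reachable_add {ω ω' : Config} {y : Site} (h : ∀ z ∈ ω, z + y ∈ ω') {a b : Site}
    (hr : (siteGraph ω).Reachable a b) : (siteGraph ω').Reachable (a + y) (b + y) := by
  let f : siteGraph ω →g siteGraph ω' :=
    { toFun := fun z => z + y
      map_rel' := fun {z z'} hz => ⟨by simpa [adjZ2] using hz.1, h _ hz.2.1, h _ hz.2.2⟩ }
  exact hr.map f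

theorem reachable_of_reachable_union_enhAt {R₀ : ℝ} {φ : Config → Config}
    (hφ : IsEnhancement R₀ φ) (hness : ¬ Essential adjZ2 φ) {R : ℤ} (hR : R₀ < R) {ω : Config}
    {y a b : Site} (ha : a - y ∉ siteBoxInt R) (hb : b - y ∉ siteBoxInt R)
    (h : (siteGraph (ω ∪ enhAt φ y ω)).Reachable a b) : (siteGraph ω).Reachable a b := by
  have h1 : (siteGraph (shiftConfig y ω ∪ φ (shiftConfig y ω))).Reachable (a + -y) (b + -y) := by
    refine reachable_add ?_ h
    rintro z (hz | ⟨z', hz', rfl⟩)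
    · left
      simpa [shiftConfig] using hz
    · right
      simpa using hz'
  have h2 := reachable_of_reachable_union hφ hness hR (by rwa [← sub_eq_add_neg])
    (by rwa [← sub_eq_add_neg]) h1
  simpa using reachable_add (ω' := ω) (y := y) (fun z hz => hz) h2

theorem enhAt_mono {φ : Config → Config} (hmono : Monotonic φ) (y : Site) {ω ω' : Config}
    (h : ω ⊆ ω') : enhAt φ y ω ⊆ enhAt φ y ω' :=
  Set.image_mono (hmono _ _ fun _ hz => h hz)

theorem reachable_of_reachable_biUnion {R₀ : ℝ} {φ : Config → Config}
    (hφ : IsEnhancement R₀ φ) (hmono : Monotonic φ) (hness : ¬ Essential adjZ2 φ) {R : ℤ}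
    (hR : R₀ < R) {a b : Site} (Y : Finset Site)
    (hY : ∀ y ∈ Y, a - y ∉ siteBoxInt R ∧ b - y ∉ siteBoxInt R) {ω : Config}
    (h : (siteGraph (ω ∪ ⋃ y ∈ Y, enhAt φ y ω)).Reachable a b) :
    (siteGraph ω).Reachable a b := by
  classical
  induction Y using Finset.induction_on generalizing ω with
  | empty => simpa using h
  | insert y Y _ ih =>
    have hy := hY y (Finset.mem_insert_self _ _)
    refine reachable_of_reachable_union_enhAt hφ hness hR hy.1 hy.2
      (ih (fun z hz => hY z (Finset.mem_insert_of_mem hz)) (h.mono (siteGraph_mono ?_)))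
    rw [Finset.set_biUnion_insert, ← union_assoc]
    exact union_subset_union_right _
      (iUnion₂_mono fun z _ => enhAt_mono hmono z subset_union_left)

/-- The box of side `4R+1` around `x`, as a finset. -/
noncomputable def boxFinset (R : ℤ) (x : Site) : Finset Site :=
  Finset.Icc (x.1 - 2 * R) (x.1 + 2 * R) ×ˢ Finset.Icc (x.2 - 2 * R) (x.2 + 2 * R)

theorem enhAt_subset_boxFinset {R₀ : ℝ} {φ : Config → Config} (hφ : IsEnhancement R₀ φ) {R : ℤ}
    (hR : R₀ < R) {x y : Site} (h : x - y ∈ siteBoxInt R) (ω : Config) :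
    enhAt φ y ω ⊆ boxFinset R x := by
  rintro _ ⟨z, hz, rfl⟩
  have hz := siteBall_subset_siteBoxInt hR (hφ.2.1 _ hz)
  simp only [siteBoxInt, mem_ofPred_eq, Prod.fst_sub, Prod.snd_sub] at h hz
  simp only [boxFinset, Finset.coe_product, Finset.coe_Icc, mem_prod, mem_Icc, Prod.fst_add,
    Prod.snd_add]
  omega

/-- Connections in the enhanced configuration persist without the enhancement once boxes around
the two end points are opened. -/
theorem connectedIn_union_of_enhanced {R₀ : ℝ} {φ : Config → Config} (hφ : IsEnhancement R₀ φ)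
    (hmono : Monotonic φ) (hness : ¬ Essential adjZ2 φ) {R : ℤ} (hR : R₀ < R) {ω : Config}
    {α : Site → Bool} {a b : Site} (h : ConnectedIn adjZ2 (enhanced φ ω α) a b) :
    ConnectedIn adjZ2 (ω ∪ ↑(boxFinset R a ∪ boxFinset R b)) a b := by
  classical
  have hR0 : 0 < R := by exact_mod_cast hφ.1.trans_lt hR
  set ω₀ : Config := ω ∪ ↑(boxFinset R a ∪ boxFinset R b) with hω₀
  obtain ⟨l, hl, hlω, hab⟩ := h
  have hcov : ∀ z ∈ l, ∃ Y : Finset Site,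
      (∀ y ∈ Y, a - y ∉ siteBoxInt R ∧ b - y ∉ siteBoxInt R) ∧
        z ∈ ω₀ ∪ ⋃ y ∈ Y, enhAt φ y ω₀ := by
    intro z hz
    rcases hlω z hz with hzω | ⟨y, -, hy⟩
    · exact ⟨∅, by simp, Or.inl (Or.inl hzω)⟩
    by_cases hya : a - y ∈ siteBoxInt R
    · refine ⟨∅, by simp, Or.inl (Or.inr ?_)⟩
      have := enhAt_subset_boxFinset hφ hR hya ω hy
      simp only [Finset.coe_union]
      exact Or.inl this
    by_cases hyb : b - y ∈ siteBoxInt R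
    · refine ⟨∅, by simp, Or.inl (Or.inr ?_)⟩
      have := enhAt_subset_boxFinset hφ hR hyb ω hy
      simp only [Finset.coe_union]
      exact Or.inr this
    refine ⟨{y}, by simpa using ⟨hya, hyb⟩, Or.inr ?_⟩
    simpa using enhAt_mono hmono y subset_union_left hy
  choose! Y hY hzY using hcov
  have hc : ConnectedIn adjZ2 (ω₀ ∪ ⋃ y ∈ l.toFinset.biUnion Y, enhAt φ y ω₀) a b := by
    refine ⟨l, hl, fun z hz => ?_, hab⟩
    rcases hzY z hz with h | h
    · exact Or.inl h
    · right
      simp only [mem_iUnion] at h ⊢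
      obtain ⟨y, hy, hzy⟩ := h
      exact ⟨y, Finset.mem_biUnion.2 ⟨z, by simpa using hz, hy⟩, hzy⟩
  rw [connectedIn_iff] at hc ⊢
  refine ⟨Or.inr ?_, reachable_of_reachable_biUnion hφ hmono hness hR _ ?_ hc.2⟩
  · have ha : a ∈ boxFinset R a := by
      simp only [boxFinset, Finset.mem_product, Finset.mem_Icc]
      omega
    exact Finset.mem_coe.2 (Finset.mem_union_left _ ha)
  · intro y hy
    obtain ⟨z, hz, hyz⟩ := Finset.mem_biUnion.1 hy
    exact hY z (by simpa using hz) y hyz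

theorem measurableSet_eval_true (z : Site) : MeasurableSet {η : Site → Bool | η z = true} :=
  measurableSet_eq_fun (measurable_pi_apply z) measurable_const

theorem measurableSet_connectedIn (x y : Site) :
    MeasurableSet {η : Site → Bool | ConnectedIn adjZ2 (toConfig η) x y} := by
  have : {η : Site → Bool | ConnectedIn adjZ2 (toConfig η) x y} =
      ⋃ l : List Site, ⋃ (_ : IsPathOn adjZ2 l ∧ l.head? = some x ∧ l.getLast? = some y),
        ⋂ z ∈ {z | z ∈ l}, {η : Site → Bool | η z = true} := by
    ext η
    simp only [ConnectedIn, toConfig, mem_ofPred_eq, mem_iUnion, mem_iInter, exists_prop]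
    exact exists_congr fun l => by tauto
  rw [this]
  refine MeasurableSet.iUnion fun l => MeasurableSet.iUnion fun _ =>
    MeasurableSet.biInter (Set.to_countable _) fun z _ => measurableSet_eval_true z

/-- The event that all sites of `F` are open. -/
def allOpen (F : Finset Site) : Set (Site → Bool) := {η | ∀ z ∈ F, η z = true}

theorem IsBernoulli.measure_allOpen {p : ℝ} {μ : Measure (Site → Bool)} (h : IsBernoulli p μ)
    (F : Finset Site) : μ (allOpen F) = ENNReal.ofReal p ^ F.card := by
  have := h.2 F fun _ => true
  simpa [cylinder, allOpen] using this

theorem measurableSet_allOpen (F : Finset Site) : MeasurableSet (allOpen F) := by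
  have : allOpen F = ⋂ z ∈ F, {η : Site → Bool | η z = true} := by
    ext; simp [allOpen]
  rw [this]
  exact Finset.measurableSet_biInter _ fun z _ => measurableSet_eval_true z

theorem generateFrom_allOpen :
    (MeasurableSpace.pi : MeasurableSpace (Site → Bool)) =
      MeasurableSpace.generateFrom (range allOpen) := by
  refine le_antisymm (iSup_le fun z => ?_)
    (MeasurableSpace.generateFrom_le (by rintro _ ⟨F, rfl⟩; exact measurableSet_allOpen F))
  rw [← measurable_iff_comap_le]
  refine @measurable_to_bool _ (MeasurableSpace.generateFrom (range allOpen)) _ ?_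
  refine MeasurableSpace.measurableSet_generateFrom ⟨{z}, ?_⟩
  ext η
  simp [allOpen]

/-- Opening all the sites of `B`. -/
def openOn (B : Finset Site) (η : Site → Bool) : Site → Bool := fun z => η z || decide (z ∈ B)

theorem measurable_openOn (B : Finset Site) : Measurable (openOn B) :=
  measurable_pi_lambda _ fun z =>
    (measurable_of_finite fun b : Bool => b || decide (z ∈ B)).comp (measurable_pi_apply z)

theorem toConfig_openOn (B : Finset Site) (η : Site → Bool) :
    toConfig (openOn B η) = toConfig η ∪ ↑B := by
  ext z
  simp [toConfig, openOn]

/-- The configuration off `B` is independent of `B` being open. -/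
theorem IsBernoulli.measure_preimage_openOn_inter {p : ℝ} {μ : Measure (Site → Bool)}
    (h : IsBernoulli p μ) (B : Finset Site) {E : Set (Site → Bool)} (hE : MeasurableSet E) :
    μ (openOn B ⁻¹' E ∩ allOpen B) = ENNReal.ofReal p ^ B.card * μ (openOn B ⁻¹' E) := by
  classical
  have := h.1
  have hpre : ∀ F, openOn B ⁻¹' allOpen F = allOpen (F \ B) := fun F => by
    ext η
    simp only [openOn, allOpen, mem_preimage, mem_ofPred_eq, Bool.or_eq_true, decide_eq_true_eq,
      Finset.mem_sdiff]
    exact forall_congr' fun z => by tauto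
  have hinter : ∀ F G, allOpen F ∩ allOpen G = allOpen (F ∪ G) := fun F G => by
    ext η
    simp only [allOpen, mem_inter_iff, mem_ofPred_eq, Finset.mem_union]
    exact ⟨fun h z hz => hz.elim (h.1 z) (h.2 z), fun h => ⟨fun z hz => h z (Or.inl hz),
      fun z hz => h z (Or.inr hz)⟩⟩
  have heq : (μ.restrict (allOpen B)).map (openOn B) =
      ENNReal.ofReal p ^ B.card • μ.map (openOn B) := by
    have hF : ∀ F, (μ.restrict (allOpen B)).map (openOn B) (allOpen F) =
        (ENNReal.ofReal p ^ B.card • μ.map (openOn B)) (allOpen F) := by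
      intro F
      rw [Measure.map_apply (measurable_openOn B) (measurableSet_allOpen F), hpre,
        Measure.restrict_apply (measurableSet_allOpen _), hinter, Measure.smul_apply,
        Measure.map_apply (measurable_openOn B) (measurableSet_allOpen F), hpre,
        h.measure_allOpen, h.measure_allOpen, smul_eq_mul, ← pow_add,
        Finset.card_union_of_disjoint Finset.sdiff_disjoint, add_comm]
    refine ext_of_generate_finite (range allOpen) generateFrom_allOpen ?_ ?_ ?_
    · rintro _ ⟨F, rfl⟩ _ ⟨G, rfl⟩ -
      exact ⟨F ∪ G, (hinter F G).symm⟩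
    · rintro _ ⟨F, rfl⟩
      exact hF F
    · have : (univ : Set (Site → Bool)) = allOpen ∅ := by ext; simp [allOpen]
      rw [this]
      exact hF ∅
  have := congrArg (fun m => m E) heq
  simp only [Measure.smul_apply, smul_eq_mul] at this
  rwa [Measure.map_apply (measurable_openOn B) hE, Measure.map_apply (measurable_openOn B) hE,
    Measure.restrict_apply (measurable_openOn B hE)] at this

theorem IsBernoulli.measure_union_le {p : ℝ} {μ : Measure (Site → Bool)} (h : IsBernoulli p μ)
    (B : Finset Site) (x y : Site) :
    ENNReal.ofReal p ^ B.card * μ {η | ConnectedIn adjZ2 (toConfig η ∪ ↑B) x y} ≤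
      μ {η | ConnectedIn adjZ2 (toConfig η) x y} := by
  have h1 := h.measure_preimage_openOn_inter B (measurableSet_connectedIn x y)
  simp only [preimage_ofPred_eq, toConfig_openOn] at h1
  rw [← h1]
  refine measure_mono ?_
  rintro η ⟨hη, hB⟩
  have hη : ConnectedIn adjZ2 (toConfig η ∪ ↑B) x y := hη
  have hB : ↑B ⊆ toConfig η := hB
  rwa [union_eq_self_of_subset_right hB] at hη

theorem card_boxFinset (R : ℤ) (x : Site) :
    (boxFinset R x).card = (4 * R + 1).toNat ^ 2 := by
  rw [boxFinset, Finset.card_product, Int.card_Icc, Int.card_Icc, sq]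
  congr 2 <;> ring

/-- for a monotonic nonessential enhancement there are constants
`c₂ ∈ (0,∞)` and `M < ∞`, depending only on the enhancement, such that for all
`s ∈ [0,1]`, `p ∈ (0, p_c]` and `x ∈ ℤ²` with `|x| ≥ M`:
`τ_p(x) ≤ τ_{p,s}(x) ≤ p^{−c₂} · τ_p(x)`. -/
theorem tau_comparison
    (P : ℝ → Measure (Site → Bool))
    (hP : ∀ p ∈ Icc (0:ℝ) 1, IsBernoulli p (P p))
    (R₀ : ℝ) (φ : Config → Config) (hφ : IsEnhancement R₀ φ)
    (hmono : Monotonic φ) (hness : ¬ Essential adjZ2 φ) :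
    ∃ c₂ M : ℝ, 0 < c₂ ∧
      ∀ s ∈ Icc (0:ℝ) 1, ∀ p : ℝ, 0 < p → p ≤ pcOf adjZ2 P →
        ∀ x : Site, M ≤ siteNorm x →
          tau adjZ2 (P p) x ≤ tauEnh adjZ2 φ (P p) (P s) x ∧
            tauEnh adjZ2 φ (P p) (P s) x ≤ p ^ (-c₂) * tau adjZ2 (P p) x := by
  obtain ⟨R, hR⟩ := exists_nat_gt R₀
  have hR : R₀ < ((R : ℤ) : ℝ) := by exact_mod_cast hR
  set k : ℕ := 2 * (4 * (R : ℤ) + 1).toNat ^ 2 with hk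
  have hk0 : 0 < k := by
    have : 0 < (4 * (R : ℤ) + 1).toNat := by omega
    positivity
  refine ⟨k, 0, by exact_mod_cast hk0, fun s hs p hp hpc x _ => ?_⟩
  have hp1 : p ≤ 1 := hpc.trans (Real.sSup_le (fun q hq => hq.1.2) zero_le_one)
  have hB := hP p ⟨hp.le, hp1⟩
  have := hB.1
  have := (hP s hs).1
  have hprod : ∀ C : Set (Site → Bool), ((P p).prod (P s)) (C ×ˢ univ) = P p C := fun C => by
    rw [Measure.prod_prod, measure_univ, mul_one]
  constructor
  · refine ENNReal.toReal_mono (measure_ne_top _ _) ?_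
    rw [← hprod]
    exact measure_mono fun ηα h => ConnectedIn.mono subset_union_left h.1
  set B := boxFinset R 0 ∪ boxFinset R x with hBdef
  have hcard : B.card ≤ k := by
    refine (Finset.card_union_le _ _).trans ?_
    rw [card_boxFinset, card_boxFinset, hk, two_mul]
  set C : Set (Site → Bool) := {η | ConnectedIn adjZ2 (toConfig η ∪ ↑B) 0 x} with hC
  have hle : tauEnh adjZ2 φ (P p) (P s) x ≤ (P p C).toReal := by
    refine ENNReal.toReal_mono (measure_ne_top _ _) ?_
    rw [← hprod]
    exact measure_mono fun ηα h =>
      ⟨connectedIn_union_of_enhanced hφ hmono hness hR h, mem_univ _⟩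
  have hC1 : p ^ B.card * (P p C).toReal ≤ tau adjZ2 (P p) x := by
    have := ENNReal.toReal_mono (measure_ne_top _ _) (hB.measure_union_le B 0 x)
    rwa [ENNReal.toReal_mul, ENNReal.toReal_pow, ENNReal.toReal_ofReal hp.le] at this
  have hpk : 0 < p ^ k := pow_pos hp k
  rw [Real.rpow_neg hp.le, Real.rpow_natCast]
  refine hle.trans ?_
  rw [inv_mul_eq_div, le_div_iff₀ hpk, mul_comm]
  exact (mul_le_mul_of_nonneg_right (pow_le_pow_of_le_one hp.le hp1 hcard)
    ENNReal.toReal_nonneg).trans hC1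

end PercEnh
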